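/- Let N ≥ 4 and 2 < p < 2*, and set θ_N := N - (N-2)p/2 (note 0 < θ_N < 2). Then there exists b₁ > 0 such that ∫_{ℝ^N_+} K(x) Ũ_ε(x)^p dx ≥ b₁ ε^{θ_N} + o(ε^{θ_N}) as ε → 0⁺; in particular, liminf_{ε→0⁺} ε^{-θ_N} ∫_{ℝ^N_+} K(x) Ũ_ε(x)^p dx > 0. -/

import Mathlib

open MeasureTheory Real Topology Filter

noncomputable section

/-- `ℝ^N` as Euclidean space. -/
abbrev Euc (N : ℕ) := EuclideanSpace ℝ (Fin N)

/-- Gaussian-type weight `K(x) = exp(|x|²/4)`. -/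
noncomputable def Kw {N : ℕ} (x : Euc N) : ℝ := Real.exp (‖x‖ ^ 2 / 4)

/-- critical Sobolev exponent `2* = 2N/(N-2)` -/
noncomputable def twoStar (N : ℕ) : ℝ := 2 * (N : ℝ) / ((N : ℝ) - 2)

/-- critical trace exponent `2_* = 2(N-1)/(N-2)` -/
noncomputable def twoStarL (N : ℕ) : ℝ := 2 * ((N : ℝ) - 1) / ((N : ℝ) - 2)

/-- `i`-th partial derivative of `u` at `x` -/
noncomputable def pd {N : ℕ} (u : Euc N → ℝ) (i : Fin N) (x : Euc N) : ℝ :=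
  fderiv ℝ u x (EuclideanSpace.single i 1)

/-- `|∇u(x)|²` -/
noncomputable def gradSq {N : ℕ} (u : Euc N → ℝ) (x : Euc N) : ℝ :=
  ∑ i, (pd u i x) ^ 2

/-- `x · ∇u(x)` -/
noncomputable def radial {N : ℕ} (u : Euc N → ℝ) (x : Euc N) : ℝ :=
  ∑ i, x i * pd u i x

/-- Laplacian `Δu(x)` -/
noncomputable def lap {N : ℕ} (u : Euc N → ℝ) (x : Euc N) : ℝ :=
  ∑ i, pd (pd u i) i x

/-- index of the vertical coordinate `x_N` -/
def lastIdx (N : ℕ) (h : 0 < N) : Fin N := ⟨N - 1, by omega⟩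

/-- open upper half-space `ℝ^N_+` -/
def upperHS (N : ℕ) (h : 0 < N) : Set (Euc N) := {x | 0 < x (lastIdx N h)}

/-- closed upper half-space -/
def upperHSc (N : ℕ) (h : 0 < N) : Set (Euc N) := {x | 0 ≤ x (lastIdx N h)}

/-- boundary hyperplane `∂ℝ^N_+` -/
def bdryHS (N : ℕ) (h : 0 < N) : Set (Euc N) := {x | x (lastIdx N h) = 0}

/-- vertical derivative `∂u/∂x_N`, taken within the closed half-space -/
noncomputable def pdN (N : ℕ) (h : 0 < N) (u : Euc N → ℝ) (x : Euc N) : ℝ :=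
  fderivWithin ℝ u (upperHSc N h) x (EuclideanSpace.single (lastIdx N h) 1)

/-- embedding of `ℝ^{N-1}` as the boundary of the half-space, `y ↦ (y, 0)` -/
noncomputable def emb (N : ℕ) (y : Euc (N - 1)) : Euc N :=
  (EuclideanSpace.equiv (Fin N) ℝ).symm
    (fun i => if hi : (i : ℕ) < N - 1 then y ⟨(i : ℕ), hi⟩ else 0)

/-- finite weighted energy, i.e. membership in the space `X` -/
def FiniteEnergy (N : ℕ) (h : 0 < N) (u : Euc N → ℝ) : Prop :=
  IntegrableOn (fun x => Kw x * (gradSq u x + (u x) ^ 2)) (upperHS N h)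

/-- classical solution of problem (1.1) -/
structure IsClassicalSolution (N : ℕ) (h : 0 < N) (lam mu p : ℝ) (u : Euc N → ℝ) : Prop where
  smooth2 : ContDiffOn ℝ 2 u (upperHS N h)
  smooth1 : ContDiffOn ℝ 1 u (upperHSc N h)
  pde : ∀ x ∈ upperHS N h,
    -lap u x - (1 / 2) * radial u x
      = lam * |u x| ^ (twoStar N - 2) * u x + mu * |u x| ^ (p - 2) * u x
  bc : ∀ x ∈ bdryHS N h,
    -pdN N h u x = Real.sqrt lam * |u x| ^ (twoStarL N - 2) * u x

/-- `x_N⁰ = √(N/(N-2))` -/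
noncomputable def xN0 (N : ℕ) : ℝ := Real.sqrt ((N : ℝ) / ((N : ℝ) - 2))

/-- `k_N = (N(N-2))^{(N-2)/4}` -/
noncomputable def kN (N : ℕ) : ℝ := ((N : ℝ) * ((N : ℝ) - 2)) ^ (((N : ℝ) - 2) / 4)

/-- `|x'|²`, squared norm of the horizontal part -/
noncomputable def horizSq {N : ℕ} (h : 0 < N) (x : Euc N) : ℝ :=
  ∑ i ∈ Finset.univ.erase (lastIdx N h), (x i) ^ 2

/-- the family `φ_{ε,τ}` -/
noncomputable def bubbleT (N : ℕ) (h : 0 < N) (ε τ : ℝ) (x : Euc N) : ℝ :=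
  (ε * Real.sqrt ((N : ℝ) * ((N : ℝ) - 2)) /
      (ε ^ 2 + horizSq h x + (x (lastIdx N h) + ε * τ * xN0 N) ^ 2)) ^ (((N : ℝ) - 2) / 2)

/-- the boundary bubble `U_ε = φ_{ε,1}` -/
noncomputable def Ubub (N : ℕ) (h : 0 < N) (ε : ℝ) (x : Euc N) : ℝ := bubbleT N h ε 1 x

/-- `K₁ = ∫_{ℝ^N_+} |∇U_ε|²` (an `ε`-independent constant, computed at `ε = 1`) -/
noncomputable def Kone (N : ℕ) (h : 0 < N) : ℝ :=
  ∫ x in upperHS N h, gradSq (Ubub N h 1) x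

/-- `K₂ = ∫_{ℝ^N_+} U_ε^{2*}` -/
noncomputable def Ktwo (N : ℕ) (h : 0 < N) : ℝ :=
  ∫ x in upperHS N h, (Ubub N h 1 x) ^ twoStar N

/-- `K₃ = ∫_{ℝ^{N-1}} U_ε(x',0)^{2_*}` -/
noncomputable def Kthree (N : ℕ) (h : 0 < N) : ℝ :=
  ∫ y : Euc (N - 1), (Ubub N h 1 (emb N y)) ^ twoStarL N

/-- cut-off function: `φ ∈ C_c^∞(ℝ^N,[0,1])`, `φ ≡ 1` on `B₁(0)`, `φ ≡ 0` outside `B₂(0)` -/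
structure IsCutoff (N : ℕ) (φ : Euc N → ℝ) : Prop where
  smooth : ContDiff ℝ (⊤ : ℕ∞) φ
  mem01 : ∀ x, φ x ∈ Set.Icc (0 : ℝ) 1
  eq_one : ∀ x ∈ Metric.closedBall (0 : Euc N) 1, φ x = 1
  eq_zero : ∀ x ∉ Metric.ball (0 : Euc N) 2, φ x = 0

/-- truncated weighted bubble `Ũ_ε = K^{-1/2} φ U_ε` -/
noncomputable def Ut (N : ℕ) (h : 0 < N) (φ : Euc N → ℝ) (ε : ℝ) (x : Euc N) : ℝ :=
  (Kw x) ^ (-(1 : ℝ) / 2) * φ x * Ubub N h ε x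

/-- smooth compactly supported test functions on the closed half-space -/
structure IsTestFun (N : ℕ) (h : 0 < N) (u : Euc N → ℝ) : Prop where
  smooth : ContDiff ℝ (⊤ : ℕ∞) u
  cpt : HasCompactSupport u
  supp : tsupport u ⊆ upperHSc N h

/-- the norm of the space `X`: `‖u‖ = (∫ K |∇u|²)^{1/2}` -/
noncomputable def Xnorm (N : ℕ) (h : 0 < N) (u : Euc N → ℝ) : ℝ :=
  Real.sqrt (∫ x in upperHS N h, Kw x * gradSq u x)



lemma aux_horiz_nonneg {N : ℕ} (h : 0 < N) (x : Euc N) : 0 ≤ horizSq h x :=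
  Finset.sum_nonneg fun _ _ => sq_nonneg _

lemma aux_norm_sq {N : ℕ} (h : 0 < N) (x : Euc N) :
    ‖x‖ ^ 2 = x (lastIdx N h) ^ 2 + horizSq h x := by
  rw [EuclideanSpace.real_norm_sq_eq, horizSq,
    Finset.add_sum_erase Finset.univ (fun i => x i ^ 2) (Finset.mem_univ _)]

lemma aux_bub_cont (N : ℕ) (hN : 4 ≤ N) (h : 0 < N) (ε : ℝ) (hε : 0 < ε) :
    Continuous (Ubub N h ε) := by
  have hN' : (4 : ℝ) ≤ N := by exact_mod_cast hN
  unfold Ubub bubbleT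
  refine Continuous.rpow_const (Continuous.div continuous_const ?_ ?_) ?_
  · unfold horizSq
    fun_prop
  · intro x
    have := aux_horiz_nonneg h x
    positivity
  · intro x
    right
    linarith

lemma aux_bub_nonneg (N : ℕ) (h : 0 < N) (ε : ℝ) (hε : 0 < ε) (x : Euc N) :
    0 ≤ Ubub N h ε x := by
  unfold Ubub bubbleT
  have := aux_horiz_nonneg h x
  positivity

lemma aux_ut_nonneg (N : ℕ) (h : 0 < N) (φ : Euc N → ℝ) (hφ : IsCutoff N φ)
    (ε : ℝ) (hε : 0 < ε) (x : Euc N) : 0 ≤ Ut N h φ ε x := by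
  unfold Ut
  have h1 := aux_bub_nonneg N h ε hε x
  have h2 := (hφ.mem01 x).1
  have h3 : 0 < Kw x := Real.exp_pos _
  positivity

lemma aux_int (N : ℕ) (hN : 4 ≤ N) (h : 0 < N) (p : ℝ) (hp : 2 < p)
    (φ : Euc N → ℝ) (hφ : IsCutoff N φ) (ε : ℝ) (hε : 0 < ε) :
    Integrable (fun x => Kw x * (Ut N h φ ε x) ^ p) := by
  have hK : Continuous (Kw : Euc N → ℝ) := by unfold Kw; fun_prop
  have hφc : Continuous φ := hφ.smooth.continuous
  have hU := aux_bub_cont N hN h ε hε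
  refine Continuous.integrable_of_hasCompactSupport ?_ ?_
  · refine hK.mul (Continuous.rpow_const ?_ (fun x => Or.inr (by linarith)))
    unfold Ut
    exact ((hK.rpow_const (fun x => Or.inl (Real.exp_pos _).ne')).mul hφc).mul hU
  · refine HasCompactSupport.intro (isCompact_closedBall (0 : Euc N) 2) ?_
    intro x hx
    have : φ x = 0 := hφ.eq_zero x (fun hx' => hx (Metric.ball_subset_closedBall hx'))
    simp only [Ut, this, mul_zero, zero_mul]
    rw [Real.zero_rpow (by linarith), mul_zero]

lemma aux_lower (N : ℕ) (hN : 4 ≤ N) (h : 0 < N) (p : ℝ) (hp : 2 < p)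
    (φ : Euc N → ℝ) (hφ : IsCutoff N φ) (ε : ℝ) (hε : 0 < ε) (hε1 : ε ≤ 1)
    (x : Euc N) (hx : ‖x‖ ≤ ε) (hx0 : 0 < x (lastIdx N h)) :
    (Real.exp (-1/8) * (Real.sqrt ((N : ℝ) * ((N : ℝ) - 2)) / (2 + (1 + xN0 N) ^ 2) / ε)
      ^ (((N : ℝ) - 2) / 2)) ^ p ≤ Kw x * (Ut N h φ ε x) ^ p := by
  have hN' : (4 : ℝ) ≤ N := by exact_mod_cast hN
  have hxsq : ‖x‖ ^ 2 ≤ ε ^ 2 := by gcongr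
  have hsplit := aux_norm_sq h x
  have hh := aux_horiz_nonneg h x
  have hx0n : 0 ≤ xN0 N := Real.sqrt_nonneg _
  have hlast : x (lastIdx N h) ≤ ε := by
    apply le_of_sq_le_sq _ hε.le
    linarith
  have hK1 : 1 ≤ Kw x := by
    unfold Kw; apply Real.one_le_exp; positivity
  have hKh : Real.exp (-1/8) ≤ (Kw x) ^ (-(1 : ℝ) / 2) := by
    unfold Kw
    rw [← Real.exp_mul, Real.exp_le_exp]
    nlinarith
  have hU : (Real.sqrt ((N : ℝ) * ((N : ℝ) - 2)) / (2 + (1 + xN0 N) ^ 2) / ε)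
      ^ (((N : ℝ) - 2) / 2) ≤ Ubub N h ε x := by
    unfold Ubub bubbleT
    refine Real.rpow_le_rpow (by positivity) ?_ (by linarith)
    have hden : ε ^ 2 + horizSq h x + (x (lastIdx N h) + ε * 1 * xN0 N) ^ 2
        ≤ (2 + (1 + xN0 N) ^ 2) * ε ^ 2 := by
      have h1 : (x (lastIdx N h) + ε * 1 * xN0 N) ^ 2 ≤ (ε + ε * 1 * xN0 N) ^ 2 := by
        gcongr
      have h2 : horizSq h x ≤ ε ^ 2 := by nlinarith [sq_nonneg (x (lastIdx N h))]
      nlinarith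
    calc _ = ε * Real.sqrt ((N : ℝ) * ((N : ℝ) - 2)) / ((2 + (1 + xN0 N) ^ 2) * ε ^ 2) := by
          field_simp
      _ ≤ _ := by
          gcongr
  have hUt : Real.exp (-1/8) * (Real.sqrt ((N : ℝ) * ((N : ℝ) - 2)) / (2 + (1 + xN0 N) ^ 2) / ε)
      ^ (((N : ℝ) - 2) / 2) ≤ Ut N h φ ε x := by
    unfold Ut
    rw [hφ.eq_one x (by simpa using hx.trans hε1), mul_one]
    gcongr
  have hUp := Real.rpow_le_rpow (by positivity) hUt (by linarith : 0 ≤ p)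
  refine hUp.trans ?_
  exact le_mul_of_one_le_left (Real.rpow_nonneg (aux_ut_nonneg N h φ hφ ε hε x) _) hK1

lemma aux_ball (N : ℕ) (h : 0 < N) (ε : ℝ) (hε : 0 < ε) (x : Euc N)
    (hx : x ∈ Metric.ball (EuclideanSpace.single (lastIdx N h) (ε / 2) : Euc N) (ε / 2)) :
    ‖x‖ ≤ ε ∧ 0 < x (lastIdx N h) := by
  rw [mem_ball_iff_norm] at hx
  constructor
  · have h1 : ‖(EuclideanSpace.single (lastIdx N h) (ε / 2) : Euc N)‖ = ε / 2 := by
      rw [EuclideanSpace.norm_single, Real.norm_of_nonneg (by positivity)]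
    have h2 := norm_le_norm_add_norm_sub' x (EuclideanSpace.single (lastIdx N h) (ε / 2) : Euc N)
    linarith
  · have h1 := PiLp.norm_apply_le (x - (EuclideanSpace.single (lastIdx N h) (ε / 2) : Euc N))
      (lastIdx N h)
    have h2 := h1.trans_lt hx
    simp only [PiLp.sub_apply, EuclideanSpace.single_apply, if_true, Real.norm_eq_abs] at h2
    have := (abs_lt.1 h2).1
    linarith

theorem statement17 (N : ℕ) (hN : 4 ≤ N) (p : ℝ) (hp1 : 2 < p) (hp2 : p < twoStar N)
    (φ : Euc N → ℝ) (hφ : IsCutoff N φ) :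
    ∃ b₁ : ℝ, 0 < b₁ ∧ ∀ᶠ ε in 𝓝[>] (0 : ℝ),
      b₁ * ε ^ ((N : ℝ) - ((N : ℝ) - 2) * p / 2)
        ≤ ∫ x in upperHS N (by omega : 0 < N), Kw x * (Ut N (by omega) φ ε x) ^ p := by
  have h : 0 < N := by omega
  have hN' : (4 : ℝ) ≤ N := by exact_mod_cast hN
  have hx0n : 0 ≤ xN0 N := Real.sqrt_nonneg _
  set A : ℝ := Real.sqrt ((N : ℝ) * ((N : ℝ) - 2)) / (2 + (1 + xN0 N) ^ 2) with hA
  have hApos : 0 < A := by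
    have : 0 < Real.sqrt ((N : ℝ) * ((N : ℝ) - 2)) :=
      Real.sqrt_pos.2 (mul_pos (by linarith) (by linarith))
    positivity
  set V : ℝ := (volume (Metric.ball (0 : Euc N) 1)).toReal with hV
  have hVpos : 0 < V :=
    ENNReal.toReal_pos (Metric.measure_ball_pos _ _ one_pos).ne' measure_ball_lt_top.ne
  refine ⟨(Real.exp (-1/8) * A ^ (((N : ℝ) - 2) / 2)) ^ p * ((1 / 2) ^ N * V), by positivity, ?_⟩
  have hev : ∀ᶠ ε in 𝓝[>] (0 : ℝ), ε ∈ Set.Ioc (0 : ℝ) 1 := Ioc_mem_nhdsGT one_pos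
  filter_upwards [hev] with ε hε
  obtain ⟨hε, hε1⟩ := hε
  set B : Set (Euc N) := Metric.ball (EuclideanSpace.single (lastIdx N h) (ε / 2) : Euc N) (ε / 2)
    with hB
  have hBsub : B ⊆ upperHS N h := fun x hx => (aux_ball N h ε hε x hx).2
  have hint := aux_int N hN h p hp1 φ hφ ε hε
  have hBvol : volume.real B = (ε / 2) ^ N * V := by
    rw [hB, Measure.real, Measure.addHaar_ball_of_pos _ _ (by positivity), ENNReal.toReal_mul,
      ENNReal.toReal_ofReal (by positivity), finrank_euclideanSpace_fin]
  have h1 : ∫ x in B, (Real.exp (-1/8) * (A / ε) ^ (((N : ℝ) - 2) / 2)) ^ p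
      ≤ ∫ x in B, Kw x * (Ut N h φ ε x) ^ p := by
    refine setIntegral_mono_on ?_ hint.integrableOn measurableSet_ball ?_
    · exact integrableOn_const measure_ball_lt_top.ne
    · intro x hx
      obtain ⟨hx1, hx2⟩ := aux_ball N h ε hε x hx
      exact aux_lower N hN h p hp1 φ hφ ε hε hε1 x hx1 hx2
  have h2 : ∫ x in B, Kw x * (Ut N h φ ε x) ^ p
      ≤ ∫ x in upperHS N h, Kw x * (Ut N h φ ε x) ^ p := by
    refine setIntegral_mono_set hint.integrableOn ?_ hBsub.eventuallyLE
    refine Eventually.of_forall fun x => ?_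
    exact mul_nonneg (Real.exp_pos _).le (Real.rpow_nonneg (aux_ut_nonneg N h φ hφ ε hε x) _)
  refine le_trans (le_of_eq ?_) (h1.trans h2)
  clear_value A
  rw [setIntegral_const, smul_eq_mul, hBvol, Real.div_rpow hApos.le hε.le, ← mul_div_assoc,
    Real.div_rpow (by positivity) (by positivity), ← Real.rpow_mul hε.le,
    Real.rpow_sub hε, Real.rpow_natCast, div_pow, div_pow, one_pow,
    show ((N : ℝ) - 2) / 2 * p = ((N : ℝ) - 2) * p / 2 by ring]
  ring
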